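/- Let ȳ_{λ_1}^{λ_2} ȳ_{λ_2}^{λ_3} ⋯ ȳ_{λ_k}^{λ_{k+1}} be an ascending path of length k ≥ 3 in Q̄_m^n with λ_{i+1} = s_{C_i}(λ_i) for circles C_i of λ_i, such that: C_i is not a circle of λ_{i−1} for 2 ≤ i ≤ k−1; C_k is a circle of each of λ_1, …, λ_k; C_k, as a circle of λ_1, is enclosed in C_1; and C_k, as a circle of λ_i, lies to the left of C_i for 2 ≤ i ≤ k−1. For 1 ≤ i ≤ k−1 set μ_{i+1} := s_{C_k}(λ_i). Assume there exists a circle of λ_1 that encloses C_k and is strictly enclosed in C_1. Then ȳ_{λ_1}^{μ_2} ȳ_{μ_2}^{μ_3} ⋯ ȳ_{μ_{k−1}}^{μ_k} ȳ_{μ_k}^{λ_{k+1}} is a path in Q̄_m^n, and both ȳ_{λ_1}^{λ_2} ⋯ ȳ_{λ_k}^{λ_{k+1}} − (−1)^{k−1} ȳ_{λ_1}^{μ_2} ȳ_{μ_2}^{μ_3} ⋯ ȳ_{μ_{k−1}}^{μ_k} ȳ_{μ_k}^{λ_{k+1}} and the reversed descending difference x̄_{λ_k}^{λ_{k+1}}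 ⋯ x̄_{λ_2}^{λ_3} x̄_{λ_1}^{λ_2} − (−1)^{k−1} x̄_{μ_k}^{λ_{k+1}} x̄_{μ_{k−1}}^{μ_k} ⋯ x̄_{μ_2}^{μ_3} x̄_{λ_1}^{μ_2} lie in the ideal Ī_m^n. -/

import Mathlib

open scoped Classical

namespace Kh

abbrev Wt (N : ℕ) := Fin N → Bool

variable {N : ℕ}

/-- A weight of type `(m,n)`: `m` downs (`true`) and `n` ups (`false`). -/
def IsWeight (m n : ℕ) (l : Wt N) : Prop :=
  {i : Fin N | l i = true}.ncard = m ∧ {i : Fin N | l i = false}.ncard = n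

/-- The height of a weight: sum over downs of the number of ups to the left. -/
noncomputable def height (l : Wt N) : ℕ :=
  ∑ i : Fin N, if l i = true then {j : Fin N | j < i ∧ l j = false}.ncard else 0

/-- Number of positions `t` with `i < t ≤ j` and value `b`. -/
noncomputable def cnt (l : Wt N) (b : Bool) (i j : Fin N) : ℕ :=
  {t : Fin N | i < t ∧ t ≤ j ∧ l t = b}.ncard

/-- `(i,j)` is a matched pair ("circle") of the standard non-crossing bracket matching
of `l` (reading `true` = ↓ as an opening bracket and `false` = ↑ as a closing bracket):
`l i = ↓`, `l j = ↑`, the segment strictly between `i` and `j` is balanced and every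
prefix of it has at least as many ↓'s as ↑'s. -/
def IsCircle (l : Wt N) (i j : Fin N) : Prop :=
  i < j ∧ l i = true ∧ l j = false ∧
    cnt l true i j + 1 = cnt l false i j ∧
    ∀ k : Fin N, i < k → k < j → cnt l false i k ≤ cnt l true i k

/-- `s_C(λ)`: exchange the values of `l` at the two positions of the circle `C = (i,j)`. -/
def swapC (l : Wt N) (i j : Fin N) : Wt N :=
  fun t => if t = i then l j else if t = j then l i else l t

/-- The circle `(i,j)` encloses the circle `(i',j')`. -/
def Encloses (i j i' j' : Fin N) : Prop := i < i' ∧ j' < j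

/-- The circle `(i,j)` lies to the left of the circle `(i',j')`. -/
def LeftOf (i j i' j' : Fin N) : Prop := j < i'

/-- The position `p` is unmatched in `l`. -/
def Unmatched (l : Wt N) (p : Fin N) : Prop :=
  ∀ q : Fin N, ¬ IsCircle l p q ∧ ¬ IsCircle l q p

/-- `def(λ)`: the number of circles of `l`. -/
noncomputable def defect (l : Wt N) : ℕ :=
  {p : Fin N × Fin N | IsCircle l p.1 p.2}.ncard

/-- One step up in the graph `Γ_m^n`: `m' = s_C(l)` for some circle `C` of `l`. -/
def GammaStep (l m' : Wt N) : Prop :=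
  ∃ i j : Fin N, IsCircle l i j ∧ m' = swapC l i j

/-- Adjacency in the graph `Γ_m^n`. -/
def GammaAdj (l m' : Wt N) : Prop := GammaStep l m' ∨ GammaStep m' l

/-- The order embedding `Fin N → Fin (N+2)` skipping the two positions `i`, `i+1`;
composing a weight with it deletes these two positions. -/
def skip2 (i : ℕ) {N : ℕ} (t : Fin N) : Fin (N + 2) :=
  if (t : ℕ) < i then Fin.castLE (Nat.le_add_right N 2) t
  else ⟨(t : ℕ) + 2, Nat.add_lt_add_right t.isLt 2⟩

end Kh

namespace Kh

variable {N : ℕ}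

/-- Type (I) elements of `S_m^n`: an ascending arrow into a vertex followed by a
descending arrow out of it (as vertex lists of the corresponding paths in `Q̄_m^n`). -/
def SType1 (p : List (Wt N)) : Prop :=
  ∃ x y z : Wt N, p = [x, y, z] ∧ GammaStep x y ∧ GammaStep z y

/-- Ascending type (II) elements of `S_m^n`: `ȳ_λ^ν ȳ_ν^μ` with `ν = s_C(λ)`,
`μ = s_{C'}(ν)`, where `C'` is a circle of `λ` enclosed in `C` or lying to the right
of `C`. -/
def SType2Asc (p : List (Wt N)) : Prop :=
  ∃ (la : Wt N) (i j i' j' : Fin N),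
    IsCircle la i j ∧ IsCircle la i' j' ∧
    (Encloses i j i' j' ∨ LeftOf i j i' j') ∧
    IsCircle (swapC la i j) i' j' ∧
    p = [la, swapC la i j, swapC (swapC la i j) i' j']

/-- Ascending type (III) elements of `S_m^n` (length `k ≥ 3`), written with 0-based
vertices `v 0, …, v k` (so `λ_t = v (t-1)`) and 1-based circles `C_i = (a i, b i)`. -/
def SType3Asc (p : List (Wt N)) : Prop :=
  ∃ (k : ℕ) (v : ℕ → Wt N) (a b : ℕ → Fin N),
    3 ≤ k ∧
    p = List.ofFn (fun t : Fin (k + 1) => v t.val) ∧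
    (∀ i, 1 ≤ i → i ≤ k →
      IsCircle (v (i - 1)) (a i) (b i) ∧ v i = swapC (v (i - 1)) (a i) (b i)) ∧
    (∀ i, 2 ≤ i → i ≤ k - 1 → ¬ IsCircle (v (i - 2)) (a i) (b i)) ∧
    (∀ j, 1 ≤ j → j ≤ k → IsCircle (v (j - 1)) (a k) (b k)) ∧
    Encloses (a 1) (b 1) (a k) (b k) ∧
    (∀ i, 2 ≤ i → i ≤ k - 1 → LeftOf (a k) (b k) (a i) (b i))

/-- Membership in the reduction set `S_m^n` (vertex-list model: the descending
elements are the reverses of the ascending ones). -/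
def InS (p : List (Wt N)) : Prop :=
  SType1 p ∨ SType2Asc p ∨ SType2Asc p.reverse ∨ SType3Asc p ∨ SType3Asc p.reverse

/-- A path in `Q̄_m^n` (given by its vertex list) is irreducible if no contiguous
subpath of it belongs to `S_m^n`. -/
def Irreducible (p : List (Wt N)) : Prop :=
  ∀ s, s <:+: p → ¬ InS s

/-- The number of ascending irreducible paths of length `k` from `la` to `mu`. -/
noncomputable def ascCount (k : ℕ) (la mu : Wt N) : ℕ :=
  {p : List (Wt N) | p.length = k + 1 ∧ p.head? = some la ∧ p.getLast? = some mu ∧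
    p.Chain' GammaStep ∧ Irreducible p}.ncard

/-- The total number of irreducible paths from `la` to `mu`. -/
noncomputable def irrCount (la mu : Wt N) : ℕ :=
  {p : List (Wt N) | p ≠ [] ∧ p.head? = some la ∧ p.getLast? = some mu ∧
    p.Chain' GammaAdj ∧ Irreducible p}.ncard

end Kh

namespace Kh

/-- The vertex set of `Q̄_m^n`: weights of type `(m,n)`. -/
def V (m n N : ℕ) := {l : Wt N // IsWeight m n l}

/-- The arrow set of `Q̄_m^n`: for adjacent weights there is one arrow in each
direction (the ascending arrow `ȳ` and the descending arrow `x̄`); an arrow is an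
ordered adjacent pair (source, target). -/
def E (m n N : ℕ) := {p : V m n N × V m n N // GammaAdj p.1.1 p.2.1}

/-- The free algebra on the vertices and arrows of `Q̄_m^n`; the path algebra
`kQ̄_m^n` is its quotient by the path-algebra relations `PARel`. -/
abbrev FA (F : Type*) [Field F] (m n N : ℕ) := FreeAlgebra F (V m n N ⊕ E m n N)

noncomputable def eV (F : Type*) [Field F] (m n N : ℕ) (v : V m n N) : FA F m n N :=
  FreeAlgebra.ι F (Sum.inl v)

noncomputable def arE (F : Type*) [Field F] (m n N : ℕ) (a : E m n N) : FA F m n N :=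
  FreeAlgebra.ι F (Sum.inr a)

/-- The idempotent `e_λ` attached to an arbitrary `l : Wt N` (zero if `l` is not
a weight of type `(m,n)`). -/
noncomputable def eW (F : Type*) [Field F] (m n N : ℕ) (l : Wt N) : FA F m n N :=
  if h : IsWeight m n l then eV F m n N ⟨l, h⟩ else 0

/-- The arrow from `u` to `w` (zero if `u`, `w` are not adjacent weights). -/
noncomputable def arW (F : Type*) [Field F] (m n N : ℕ) (u w : Wt N) : FA F m n N :=
  if h : IsWeight m n u ∧ IsWeight m n w ∧ GammaAdj u w then
    arE F m n N ⟨(⟨u, h.1⟩, ⟨w, h.2.1⟩), h.2.2⟩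
  else 0

/-- The element of the (free algebra presenting the) path algebra corresponding to
the path with the given vertex list. -/
noncomputable def pathEl (F : Type*) [Field F] (m n N : ℕ) : List (Wt N) → FA F m n N
  | [] => 0
  | [u] => eW F m n N u
  | u :: w :: rest => arW F m n N u w * pathEl F m n N (w :: rest)

/-- The defining relations of the path algebra `kQ̄_m^n` as a quotient of the free
algebra on vertices and arrows: the vertices are orthogonal idempotents summing to
`1` and each arrow is supported at its source and target. -/
inductive PARel (F : Type*) [Field F] (m n N : ℕ) : FA F m n N → FA F m n N → Prop
  | idem (v : V m n N) : PARel F m n N (eV F m n N v * eV F m n N v) (eV F m n N v)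
  | orth (v w : V m n N) (h : v ≠ w) : PARel F m n N (eV F m n N v * eV F m n N w) 0
  | src (a : E m n N) :
      PARel F m n N (eV F m n N a.1.1 * arE F m n N a) (arE F m n N a)
  | tgt (a : E m n N) :
      PARel F m n N (arE F m n N a * eV F m n N a.1.2) (arE F m n N a)
  | srcZero (v : V m n N) (a : E m n N) (h : v ≠ a.1.1) :
      PARel F m n N (eV F m n N v * arE F m n N a) 0
  | tgtZero (a : E m n N) (v : V m n N) (h : v ≠ a.1.2) :
      PARel F m n N (arE F m n N a * eV F m n N v) 0
  | unit : PARel F m n N (∑ᶠ v : V m n N, eV F m n N v) 1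

/-- The coefficient `c_κ^μ(λ)` where `λ = s_D(κ)` with `D = (d1,d2)`, and
`μ = s_C(λ)` with `C = (i,j)` a circle of `λ`. -/
noncomputable def cCoef {N : ℕ} (ka : Wt N) (d1 d2 i j : Fin N) : ℤ :=
  if IsCircle ka i j then
    if Encloses i j d1 d2 then
      (-1) ^ ({p : Fin N × Fin N |
        IsCircle ka p.1 p.2 ∧ Encloses p.1 p.2 d1 d2 ∧ Encloses i j p.1 p.2}.ncard) * 2
    else 0
  else 1

/-- Generator of type (A): the sum of all length-2 paths from `la` to `mu`. -/
noncomputable def GenA (F : Type*) [Field F] (m n N : ℕ) (la mu : Wt N) : FA F m n N :=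
  ∑ᶠ nu : Wt N, arW F m n N la nu * arW F m n N nu mu

/-- Generator of type (D): `ȳ_λ^μ x̄_λ^μ + Σ_κ c_κ^μ(λ) x̄_κ^λ ȳ_κ^λ`, for `λ` a
weight with circle `C = (i,j)` and `μ = s_C(λ)`. -/
noncomputable def GenD (F : Type*) [Field F] (m n N : ℕ) (la : Wt N) (i j : Fin N) :
    FA F m n N :=
  arW F m n N la (swapC la i j) * arW F m n N (swapC la i j) la +
    ∑ᶠ ka : Wt N, ∑ᶠ d1 : Fin N, ∑ᶠ d2 : Fin N,
      if IsCircle ka d1 d2 ∧ la = swapC ka d1 d2 then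
        cCoef ka d1 d2 i j • (arW F m n N la ka * arW F m n N ka la)
      else 0

/-- The relations presenting `K̄_m^n = kQ̄_m^n / Ī_m^n`: the path-algebra relations
together with the quadratic generators (A)–(D) of the ideal `Ī_m^n`. -/
inductive KbarRel (F : Type*) [Field F] (m n N : ℕ) : FA F m n N → FA F m n N → Prop
  | pa {x y : FA F m n N} : PARel F m n N x y → KbarRel F m n N x y
  | genA (la mu : Wt N) (h1 : IsWeight m n la) (h2 : IsWeight m n mu) (hne : la ≠ mu)
      (htwo : 2 ≤ {nu : Wt N | GammaAdj la nu ∧ GammaAdj nu mu}.ncard) :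
      KbarRel F m n N (GenA F m n N la mu) 0
  | genB1 (la : Wt N) (h : IsWeight m n la) (i j i' j' : Fin N)
      (hC : IsCircle la i j) (hC' : IsCircle la i' j') (henc : Encloses i j i' j')
      (hno : ¬ ∃ a b : Fin N, IsCircle la a b ∧ Encloses a b i' j' ∧ Encloses i j a b) :
      KbarRel F m n N
        (arW F m n N la (swapC la i j) *
          arW F m n N (swapC la i j) (swapC (swapC la i j) i' j')) 0
  | genB2 (la : Wt N) (h : IsWeight m n la) (i j i' j' : Fin N)
      (hC : IsCircle la i j) (hC' : IsCircle la i' j') (henc : Encloses i j i' j')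
      (hno : ¬ ∃ a b : Fin N, IsCircle la a b ∧ Encloses a b i' j' ∧ Encloses i j a b) :
      KbarRel F m n N
        (arW F m n N (swapC (swapC la i j) i' j') (swapC la i j) *
          arW F m n N (swapC la i j) la) 0
  | genC (la mu : Wt N) (h1 : IsWeight m n la) (h2 : IsWeight m n mu) (hne : la ≠ mu)
      (c1 c2 d1 d2 : Fin N) (hC : IsCircle la c1 c2) (hC'' : IsCircle mu d1 d2)
      (hsw : swapC la c1 c2 = swapC mu d1 d2)
      (hcross : (c1 < d1 ∧ d1 < c2 ∧ c2 < d2) ∨ (d1 < c1 ∧ c1 < d2 ∧ d2 < c2)) :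
      KbarRel F m n N
        (arW F m n N la (swapC la c1 c2) * arW F m n N (swapC la c1 c2) mu) 0
  | genD (la : Wt N) (h : IsWeight m n la) (i j : Fin N) (hC : IsCircle la i j) :
      KbarRel F m n N (GenD F m n N la i j) 0

/-- The Koszul dual `K̄_m^n` of the extended Khovanov arc algebra, presented as a
quotient of the free algebra on the vertices and arrows of `Q̄_m^n`. -/
abbrev Kbar (F : Type*) [Field F] (m n N : ℕ) := RingQuot (KbarRel F m n N)

/-- The canonical projection; an element of the path algebra lies in the ideal
`Ī_m^n` if and only if its image under this map is zero. -/
noncomputable def toKbar (F : Type*) [Field F] (m n N : ℕ) :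
    FA F m n N →ₐ[F] Kbar F m n N :=
  RingQuot.mkAlgHom F (KbarRel F m n N)

/-- The degree-`i` component of `K̄_m^n` (image of the span of the length-`i` paths). -/
noncomputable def degComp (F : Type*) [Field F] (m n N : ℕ) (i : ℕ) :
    Submodule F (Kbar F m n N) :=
  Submodule.span F {x : Kbar F m n N | ∃ p : List (Wt N),
    p.length = i + 1 ∧ (∀ v ∈ p, IsWeight m n v) ∧ p.Chain' GammaAdj ∧
    x = toKbar F m n N (pathEl F m n N p)}

/-- The linear map `x ↦ e_λ x e_μ` on `K̄_m^n`. -/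
noncomputable def sandwich (F : Type*) [Field F] (m n N : ℕ) (la mu : Wt N) :
    Kbar F m n N →ₗ[F] Kbar F m n N :=
  (LinearMap.mulLeft F (toKbar F m n N (eW F m n N la))).comp
    (LinearMap.mulRight F (toKbar F m n N (eW F m n N mu)))

end Kh

namespace Kh

variable {N : ℕ}

/-- Prefix sums: number of downs minus number of ups among positions `< x`. -/
noncomputable def SS (l : Wt N) (x : ℕ) : ℤ :=
  ∑ t : Fin N, if t.val < x then (if l t = true then 1 else -1) else 0

theorem SS_succ (l : Wt N) (i : Fin N) :
    SS l (i.val + 1) = SS l i.val + (if l i = true then 1 else -1) := by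
  unfold SS
  have : ∀ t : Fin N, (if t.val < i.val + 1 then (if l t = true then (1:ℤ) else -1) else 0)
      = (if t.val < i.val then (if l t = true then 1 else -1) else 0) +
        (if t = i then (if l i = true then 1 else -1) else 0) := by
    intro t
    by_cases h : t = i
    · subst h; simp
    · have h' : t.val ≠ i.val := fun hh => h (Fin.ext hh)
      have : t.val < i.val + 1 ↔ t.val < i.val := by omega
      simp [h, this]
  rw [Finset.sum_congr rfl (fun t _ => this t), Finset.sum_add_distrib]
  simp

theorem cnt_eq (l : Wt N) (b : Bool) (i j : Fin N) :
    (cnt l b i j : ℤ) = ∑ t : Fin N, if i < t ∧ t ≤ j ∧ l t = b then (1:ℤ) else 0 := by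
  unfold cnt
  rw [Set.ncard_eq_toFinset_card']
  simp [Finset.sum_ite]

theorem cnt_sub (l : Wt N) (i j : Fin N) (h : i ≤ j) :
    (cnt l true i j : ℤ) - cnt l false i j = SS l (j.val + 1) - SS l (i.val + 1) := by
  rw [cnt_eq, cnt_eq, SS, SS, ← Finset.sum_sub_distrib, ← Finset.sum_sub_distrib]
  refine Finset.sum_congr rfl (fun t _ => ?_)
  simp only [Fin.lt_def, Fin.le_def] at *
  cases hl : l t <;> simp <;> split_ifs <;> first | rfl | omega

theorem isCircle_iff (l : Wt N) (i j : Fin N) :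
    IsCircle l i j ↔ i.val < j.val ∧ SS l (j.val + 1) = SS l i.val ∧
      ∀ x : ℕ, i.val < x → x ≤ j.val → SS l i.val < SS l x := by
  have hi := SS_succ l i
  have hj := SS_succ l j
  constructor
  · rintro ⟨h1, h2, h3, h4, h5⟩
    have h6 := cnt_sub l i j h1.le
    rw [if_pos h2] at hi
    refine ⟨h1, by omega, ?_⟩
    intro x hx hxj
    rcases Nat.eq_or_lt_of_le (Nat.succ_le_of_lt hx) with h | h
    · rw [← h]; simp only [Nat.succ_eq_add_one]; omega
    · have hk := h5 ⟨x - 1, by omega⟩ (by rw [Fin.lt_def]; simp; omega)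
        (by rw [Fin.lt_def]; simp; omega)
      have := cnt_sub l i ⟨x - 1, by omega⟩ (by rw [Fin.le_def]; simp; omega)
      simp only [show x - 1 + 1 = x by omega] at this
      omega
  · rintro ⟨h1, h2, h3⟩
    have a1 := h3 (i.val + 1) (by omega) (by omega)
    have a2 := h3 j.val (by omega) (by omega)
    have hli : l i = true := by
      by_contra h; rw [if_neg h] at hi; omega
    have hlj : l j = false := by
      by_contra h; rw [if_pos (by simpa using h)] at hj; omega
    rw [if_pos hli] at hi
    refine ⟨h1, hli, hlj, ?_, ?_⟩
    · have h6 := cnt_sub l i j (Fin.le_def.2 h1.le)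
      omega
    · intro k hk1 hk2
      have h6 := cnt_sub l i k hk1.le
      have := h3 (k.val + 1) (by rw [Fin.lt_def] at hk1; omega)
        (by rw [Fin.lt_def] at hk2; omega)
      omega

theorem SS_swap (l : Wt N) (i j : Fin N) (h : i < j) (hi : l i = true) (hj : l j = false)
    (x : ℕ) :
    SS (swapC l i j) x = SS l x - (if i.val < x ∧ x ≤ j.val then 2 else 0) := by
  have key : ∀ t : Fin N, (if t.val < x then (if swapC l i j t = true then (1:ℤ) else -1) else 0)
      = (if t.val < x then (if l t = true then 1 else -1) else 0) +
        ((if t = i then (if i.val < x then -2 else 0) else 0) +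
         (if t = j then (if j.val < x then 2 else 0) else 0)) := by
    intro t
    unfold swapC
    have hij : i ≠ j := h.ne
    by_cases h1 : t = i
    · subst h1; by_cases hx : t.val < x <;> simp [hx, hi, hj, hij]
    · by_cases h2 : t = j
      · subst h2; by_cases hx : t.val < x <;> simp [hx, hi, hj, h1]
      · simp [h1, h2]
  unfold SS
  rw [Finset.sum_congr rfl (fun t _ => key t), Finset.sum_add_distrib, Finset.sum_add_distrib]
  rw [Fin.lt_def] at h
  simp only [Finset.sum_ite_eq', Finset.mem_univ, if_true]
  split_ifs <;> first | omega | (exfalso; omega)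

theorem swapC_invol (l : Wt N) (i j : Fin N) : swapC (swapC l i j) i j = l := by
  funext t; unfold swapC; by_cases h1 : t = i <;> by_cases h2 : t = j <;> by_cases h3 : j = i <;>
    simp_all

theorem swapC_weight {m n : ℕ} (l : Wt N) (i j : Fin N) (h : IsWeight m n l) :
    IsWeight m n (swapC l i j) := by
  have e : swapC l i j = l ∘ (Equiv.swap i j) := by
    funext t; simp only [swapC, Function.comp, Equiv.swap_apply_def]; split_ifs <;> rfl
  have key : ∀ b : Bool, {t : Fin N | swapC l i j t = b}.ncard = {t : Fin N | l t = b}.ncard := by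
    intro b
    rw [← Set.ncard_image_of_injective {t : Fin N | swapC l i j t = b} (Equiv.swap i j).injective]
    congr 1
    ext t
    rw [e]
    simp only [Set.mem_image, Set.mem_setOf_eq, Function.comp]
    constructor
    · rintro ⟨x, hx, rfl⟩; exact hx
    · intro hx; exact ⟨Equiv.swap i j t, by simpa using hx, by simp⟩
  exact ⟨(key true).trans h.1, (key false).trans h.2⟩

theorem adj_form {l nu : Wt N} (h : GammaAdj l nu) : ∃ i j : Fin N, i < j ∧ nu = swapC l i j ∧
    (IsCircle l i j ∨ (l i = false ∧ l j = true ∧ IsCircle nu i j)) := by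
  rcases h with ⟨i, j, hc, rfl⟩ | ⟨i, j, hc, rfl⟩
  · exact ⟨i, j, hc.1, rfl, Or.inl hc⟩
  · refine ⟨i, j, hc.1, (swapC_invol _ _ _).symm, Or.inr ⟨?_, ?_, hc⟩⟩
    · simp [swapC, hc.2.2.1]
    · have : j ≠ i := hc.1.ne'
      simp [swapC, this, hc.2.1]

/-- The local configuration for one commuting square. -/
structure Sq (l : Wt N) (c d e f : Fin N) : Prop where
  hC : IsCircle l c d
  hD : IsCircle l e f
  hpq : ∃ p q : Fin N, IsCircle l p q ∧ p < c ∧ d < q ∧ ((e < p ∧ q < f) ∨ q < e)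

theorem Sq.circ {l : Wt N} {c d e f : Fin N} (h : Sq l c d e f) :
    IsCircle (swapC l c d) e f := by
  obtain ⟨hC, hD, p, q, hp, hpc, hdq, hh⟩ := h
  have S := SS_swap l c d hC.1 hC.2.1 hC.2.2.1
  rw [isCircle_iff] at *
  obtain ⟨C1, C2, C3⟩ := hC
  obtain ⟨D1, D2, D3⟩ := hD
  obtain ⟨P1, P2, P3⟩ := hp
  simp only [Fin.lt_def] at *
  refine ⟨D1, ?_, ?_⟩
  · rw [S, S, if_neg (by omega), if_neg (by omega)]; omega
  · intro x hx1 hx2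
    rw [S, S, if_neg (by omega : ¬ (c.val < e.val ∧ e.val ≤ d.val))]
    have := D3 x hx1 hx2
    split_ifs with hx
    · rcases hh with hh | hh
      · have := D3 p.val (by omega) (by omega)
        have := P3 c.val (by omega) (by omega)
        have := C3 x hx.1 hx.2
        omega
      · omega
    · omega

theorem Sq.ne {l : Wt N} {c d e f : Fin N} (h : Sq l c d e f) :
    c ≠ d ∧ c ≠ e ∧ c ≠ f ∧ d ≠ e ∧ d ≠ f ∧ e ≠ f := by
  obtain ⟨hC, hD, p, q, hp, hpc, hdq, hh⟩ := h
  have := hC.1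
  have := hD.1
  have := hp.1
  simp only [Fin.lt_def, ne_eq, Fin.ext_iff] at *
  omega

theorem Sq.comm {l : Wt N} {c d e f : Fin N} (h : Sq l c d e f) :
    swapC (swapC l c d) e f = swapC (swapC l e f) c d := by
  obtain ⟨h1, h2, h3, h4, h5, h6⟩ := h.ne
  funext t
  unfold swapC
  by_cases t1 : t = c
  · subst t1; simp [*]
  by_cases t2 : t = d
  · subst t2; simp [*]
  by_cases t3 : t = e
  · subst t3; simp [h2.symm, h4.symm, h3.symm, h5.symm, *]
  by_cases t4 : t = f
  · subst t4; simp [h2.symm, h4.symm, h3.symm, h5.symm, h6.symm, *]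
  simp [*]

theorem swap_ne {l : Wt N} {i j x : Fin N} (h : swapC l i j x ≠ l x) : x = i ∨ x = j := by
  by_contra hh
  push Not at hh
  apply h
  simp [swapC, hh.1, hh.2]

theorem circ_unique_right {l : Wt N} {i j j' : Fin N} (h : IsCircle l i j)
    (h' : IsCircle l i j') : j = j' := by
  rw [isCircle_iff] at h h'
  obtain ⟨a1, a2, a3⟩ := h
  obtain ⟨b1, b2, b3⟩ := h'
  by_contra hne
  have hne' : j.val ≠ j'.val := fun hh => hne (Fin.ext hh)
  rcases Nat.lt_or_gt_of_ne hne' with hl | hl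
  · have := b3 (j.val + 1) (by omega) (by omega); omega
  · have := a3 (j'.val + 1) (by omega) (by omega); omega

theorem circ_unique_left {l : Wt N} {i i' j : Fin N} (h : IsCircle l i j)
    (h' : IsCircle l i' j) : i = i' := by
  rw [isCircle_iff] at h h'
  obtain ⟨a1, a2, a3⟩ := h
  obtain ⟨b1, b2, b3⟩ := h'
  by_contra hne
  have hne' : i.val ≠ i'.val := fun hh => hne (Fin.ext hh)
  rcases Nat.lt_or_gt_of_ne hne' with hl | hl
  · have := a3 i'.val (by omega) (by omega); omega
  · have := b3 i.val (by omega) (by omega); omega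

theorem Sq.uniq {l : Wt N} {c d e f : Fin N} (h : Sq l c d e f) {nu : Wt N}
    (h1 : GammaAdj l nu) (h2 : GammaAdj nu (swapC (swapC l c d) e f)) :
    nu = swapC l c d ∨ nu = swapC l e f := by
  obtain ⟨i, j, hij, hnu, hcase⟩ := adj_form h1
  obtain ⟨i', j', hij', hmu, -⟩ := adj_form h2
  obtain ⟨n1, n2, n3, n4, n5, n6⟩ := h.ne
  obtain ⟨hC, hD, p, q, hp, hpc, hdq, hh⟩ := h
  have lc := hC.2.1
  have ld := hC.2.2.1
  have le := hD.2.1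
  have lf := hD.2.2.1
  have mem : ∀ x, swapC (swapC l c d) e f x ≠ l x → x = i ∨ x = j ∨ x = i' ∨ x = j' := by
    intro x hx
    by_cases hx2 : nu x = l x
    · rw [hmu, ← hx2] at hx
      have := swap_ne hx
      tauto
    · rw [hnu] at hx2
      have := swap_ne hx2
      tauto
  have mc := mem c (by simp [swapC, lc, ld, *])
  have md := mem d (by simp [swapC, lc, ld, n1.symm, *])
  have me := mem e (by simp [swapC, le, lf, n2.symm, n4.symm, n3.symm, n5.symm])
  have mf := mem f (by simp [swapC, le, lf, n2.symm, n4.symm, n3.symm, n5.symm, n6.symm])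
  clear mem
  have hi : i = c ∨ i = d ∨ i = e ∨ i = f := by
    simp only [ne_eq, Fin.ext_iff] at *; omega
  have hj : j = c ∨ j = d ∨ j = e ∨ j = f := by
    simp only [ne_eq, Fin.ext_iff] at *; omega
  clear mc md me mf
  have lij : l i ≠ l j := by
    rcases hcase with hc | hc
    · rw [hc.2.1, hc.2.2.1]; simp
    · rw [hc.1, hc.2.1]; simp
  have bad : ¬ (i = d ∧ j = e) := by
    rintro ⟨rfl, rfl⟩
    rcases hcase with hc | ⟨-, -, hc⟩
    · have := hc.2.1; simp_all
    · have hl : l = swapC nu i j := by rw [hnu, swapC_invol]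
      have S := SS_swap nu i j hij hc.2.1 hc.2.2.1
      rw [← hl] at S
      rw [isCircle_iff] at hC hc hp
      obtain ⟨C1, C2, C3⟩ := hC
      obtain ⟨D1, D2, D3⟩ := hc
      obtain ⟨P1, P2, P3⟩ := hp
      simp only [Fin.lt_def] at *
      have a1 := D3 (q.val + 1) (by omega) (by omega)
      have a2 := S (q.val + 1)
      have a3 := S i.val
      rw [if_pos (by omega)] at a2
      rw [if_neg (by omega)] at a3
      have := P3 c.val (by omega) (by omega)
      have := SS_succ l i
      rw [ld] at this
      simp at this
      omega
  have hcd := hC.1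
  have hef := hD.1
  have hpq := hp.1
  have key : (i = c ∧ j = d) ∨ (i = e ∧ j = f) := by
    rcases hi with rfl | rfl | rfl | rfl <;> rcases hj with rfl | rfl | rfl | rfl <;>
      first
      | exact Or.inl ⟨rfl, rfl⟩
      | exact Or.inr ⟨rfl, rfl⟩
      | exact absurd rfl lij
      | exact absurd (lc.trans le.symm) lij
      | exact absurd (le.trans lc.symm) lij
      | exact absurd (ld.trans lf.symm) lij
      | exact absurd (lf.trans ld.symm) lij
      | exact absurd ⟨rfl, rfl⟩ bad
      | (exfalso; simp only [Fin.lt_def] at *; omega)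
      | (exfalso
         rcases hcase with hc | ⟨hc, -, -⟩
         · first
           | exact n5 (circ_unique_right hC hc)
           | exact n5 (circ_unique_right hc hD)
           | exact n2 (circ_unique_left hC hc)
           | exact n2 (circ_unique_left hc hD)
         · simp_all)
  rcases key with ⟨rfl, rfl⟩ | ⟨rfl, rfl⟩
  · exact Or.inl hnu
  · exact Or.inr hnu

theorem Sq.nu_ne {l : Wt N} {c d e f : Fin N} (h : Sq l c d e f) :
    swapC l c d ≠ swapC l e f := by
  obtain ⟨n1, n2, n3, n4, n5, n6⟩ := h.ne
  intro hh
  have := congrFun hh c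
  simp [swapC, n2, n3, h.hC.2.1, h.hC.2.2.1] at this

theorem GammaAdj.symm' {l l' : Wt N} (h : GammaAdj l l') : GammaAdj l' l := Or.symm h

section alg
variable (F : Type*) [Field F] (m n : ℕ)

theorem genA_two (la mu x y : Wt N) (h1 : IsWeight m n la) (h2 : IsWeight m n mu)
    (hne : la ≠ mu) (hxy : x ≠ y) (hx : GammaAdj la x ∧ GammaAdj x mu)
    (hy : GammaAdj la y ∧ GammaAdj y mu)
    (huniq : ∀ nu, GammaAdj la nu → GammaAdj nu mu → nu = x ∨ nu = y) :
    toKbar F m n N (arW F m n N la x) * toKbar F m n N (arW F m n N x mu) =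
      (-1 : F) • (toKbar F m n N (arW F m n N la y) * toKbar F m n N (arW F m n N y mu)) := by
  have hset : {nu : Wt N | GammaAdj la nu ∧ GammaAdj nu mu} = {x, y} := by
    ext nu
    simp only [Set.mem_setOf_eq, Set.mem_insert_iff, Set.mem_singleton_iff]
    constructor
    · rintro ⟨p, q⟩; exact huniq nu p q
    · rintro (rfl | rfl)
      · exact hx
      · exact hy
  have hrel := KbarRel.genA (F := F) la mu h1 h2 hne (by rw [hset, Set.ncard_pair hxy])
  have h0 : toKbar F m n N (GenA F m n N la mu) = 0 := by
    rw [← map_zero (toKbar F m n N)]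
    exact RingQuot.mkAlgHom_rel F hrel
  have hsum : GenA F m n N la mu = arW F m n N la x * arW F m n N x mu +
      arW F m n N la y * arW F m n N y mu := by
    unfold GenA
    rw [finsum_eq_sum_of_support_subset (s := {x, y})]
    · rw [Finset.sum_pair hxy]
    · intro nu hnu
      rw [Function.mem_support] at hnu
      have a1 : arW F m n N la nu ≠ 0 := left_ne_zero_of_mul hnu
      have a2 : arW F m n N nu mu ≠ 0 := right_ne_zero_of_mul hnu
      have b1 : GammaAdj la nu := by
        by_contra hc; apply a1; unfold arW; rw [dif_neg]; tauto
      have b2 : GammaAdj nu mu := by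
        by_contra hc; apply a2; unfold arW; rw [dif_neg]; tauto
      simpa using huniq nu b1 b2
  rw [hsum, map_add, map_mul, map_mul] at h0
  generalize toKbar F m n N (arW F m n N la x) * toKbar F m n N (arW F m n N x mu) = X at h0 ⊢
  generalize toKbar F m n N (arW F m n N la y) * toKbar F m n N (arW F m n N y mu) = Y at h0 ⊢
  have hY := add_smul (1 : F) (-1) Y
  rw [add_neg_cancel, zero_smul, one_smul] at hY
  rw [← zero_add ((-1 : F) • Y), ← h0, add_assoc, ← hY, add_zero]

theorem asc_claim (j : ℕ) : ∀ (v w : ℕ → Wt N), v (j + 1) = w j →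
    (∀ t, t < j →
      toKbar F m n N (arW F m n N (v t) (v (t+1))) * toKbar F m n N (arW F m n N (v (t+1)) (w (t+1)))
      = (-1 : F) • (toKbar F m n N (arW F m n N (v t) (w t)) * toKbar F m n N (arW F m n N (w t) (w (t+1))))) →
    toKbar F m n N (pathEl F m n N (List.ofFn (fun t : Fin (j + 2) => v t.val))) =
      ((-1 : F) ^ j) • toKbar F m n N
        (pathEl F m n N (v 0 :: List.ofFn (fun t : Fin (j + 1) => w t.val))) := by
  induction j with
  | zero =>
    intro v w h _
    simp at h
    simp [List.ofFn_succ, h]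
  | succ j ih =>
    intro v w h hsq
    have := ih (fun t => v (t + 1)) (fun t => w (t + 1)) h (fun t ht => hsq (t + 1) (by omega))
    have e1 : List.ofFn (fun t : Fin (j + 1 + 2) => v t.val) =
        v 0 :: v 1 :: List.ofFn (fun t : Fin (j + 1) => v (t.val + 2)) := by
      simp [List.ofFn_succ]
    have e2 : List.ofFn (fun t : Fin (j + 2) => v (t.val + 1)) =
        v 1 :: List.ofFn (fun t : Fin (j + 1) => v (t.val + 2)) := by
      simp [List.ofFn_succ]
    have e3 : List.ofFn (fun t : Fin (j + 1 + 1) => w t.val) =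
        w 0 :: w 1 :: List.ofFn (fun t : Fin j => w (t.val + 2)) := by
      simp [List.ofFn_succ]
    have e4 : List.ofFn (fun t : Fin (j + 1) => w (t.val + 1)) =
        w 1 :: List.ofFn (fun t : Fin j => w (t.val + 2)) := by
      simp [List.ofFn_succ]
    have s0 := hsq 0 (by omega)
    simp only [zero_add] at s0
    rw [e2, e4] at this
    rw [e1, e3]
    simp only [pathEl, map_mul] at this ⊢
    rw [this, mul_smul_comm, ← mul_assoc, s0, pow_succ, mul_smul, smul_mul_assoc,
      mul_assoc]

theorem desc_claim (j : ℕ) (v w : ℕ → Wt N) :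
    (∀ t, t < j →
      toKbar F m n N (arW F m n N (w (t+1)) (v (t+1))) * toKbar F m n N (arW F m n N (v (t+1)) (v t))
      = (-1 : F) • (toKbar F m n N (arW F m n N (w (t+1)) (w t)) * toKbar F m n N (arW F m n N (w t) (v t)))) →
    toKbar F m n N
      (pathEl F m n N (w j :: (List.ofFn (fun t : Fin (j + 1) => v t.val)).reverse)) =
      ((-1 : F) ^ j) • toKbar F m n N
        (pathEl F m n N ((List.ofFn (fun t : Fin (j + 1) => w t.val)).reverse ++ [v 0])) := by
  induction j with
  | zero => intro _; simp
  | succ j ih =>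
    intro hsq
    have := ih (fun t ht => hsq t (by omega))
    have key : ∀ (u : ℕ → Wt N) (j : ℕ), (List.ofFn (fun t : Fin (j + 1) => u t.val)).reverse =
        u j :: (List.ofFn (fun t : Fin j => u t.val)).reverse := by
      intro u j
      rw [List.ofFn_succ']
      simp
    have s0 := hsq j (by omega)
    rw [key v (j + 1), key w (j + 1)]
    rw [key v j, key w j] at this ⊢
    simp only [List.cons_append, pathEl, map_mul] at this ⊢
    rw [← mul_assoc, s0, smul_mul_assoc, mul_assoc, this, mul_smul_comm, pow_succ', mul_smul]

theorem Sq.asc {m n : ℕ} {l : Wt N} {c d e f : Fin N} (h : Sq l c d e f)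
    (hw : IsWeight m n l) (hC' : IsCircle (swapC l e f) c d) :
    toKbar F m n N (arW F m n N l (swapC l e f)) *
        toKbar F m n N (arW F m n N (swapC l e f) (swapC (swapC l e f) c d)) =
      (-1 : F) • (toKbar F m n N (arW F m n N l (swapC l c d)) *
        toKbar F m n N (arW F m n N (swapC l c d) (swapC (swapC l e f) c d))) ∧
    toKbar F m n N (arW F m n N (swapC (swapC l e f) c d) (swapC l e f)) *
        toKbar F m n N (arW F m n N (swapC l e f) l) =
      (-1 : F) • (toKbar F m n N (arW F m n N (swapC (swapC l e f) c d) (swapC l c d)) *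
        toKbar F m n N (arW F m n N (swapC l c d) l)) := by
  have g1 : GammaAdj l (swapC l e f) := Or.inl ⟨e, f, h.hD, rfl⟩
  have g2 : GammaAdj (swapC l e f) (swapC (swapC l e f) c d) := Or.inl ⟨c, d, hC', rfl⟩
  have g3 : GammaAdj l (swapC l c d) := Or.inl ⟨c, d, h.hC, rfl⟩
  have g4 : GammaAdj (swapC l c d) (swapC (swapC l e f) c d) :=
    Or.inl ⟨e, f, h.circ, h.comm.symm⟩
  have w1 := swapC_weight (swapC l e f) c d (swapC_weight l e f hw)
  have hne : l ≠ swapC (swapC l e f) c d := by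
    intro hh
    obtain ⟨n1, n2, n3, n4, n5, n6⟩ := h.ne
    have := congrFun hh c
    simp [swapC, n4, n5, h.hC.2.1, h.hC.2.2.1] at this
  have hu := fun nu => @Sq.uniq N l c d e f h nu
  rw [h.comm] at hu
  refine ⟨genA_two F m n _ _ _ _ hw w1 hne h.nu_ne.symm ⟨g1, g2⟩ ⟨g3, g4⟩ ?_,
    genA_two F m n _ _ _ _ w1 hw hne.symm h.nu_ne.symm ⟨g2.symm', g1.symm'⟩
      ⟨g4.symm', g3.symm'⟩ ?_⟩
  · intro nu a1 a2; exact (hu nu a1 a2).symm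
  · intro nu a1 a2; exact (hu nu a2.symm' a1.symm').symm

end alg

/-- A circle only depends on the values of the weight on the segment it spans. -/
theorem circ_congr {l l' : Wt N} {i j : Fin N} (h : ∀ t, i ≤ t → t ≤ j → l t = l' t)
    (hc : IsCircle l i j) : IsCircle l' i j := by
  have hcnt : ∀ (b : Bool) (k : Fin N), k ≤ j → cnt l b i k = cnt l' b i k := by
    intro b k hk
    unfold cnt
    congr 1
    ext t
    simp only [Set.mem_setOf_eq]
    constructor
    · rintro ⟨a1, a2, a3⟩; exact ⟨a1, a2, by rw [← h t a1.le (a2.trans hk)]; exact a3⟩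
    · rintro ⟨a1, a2, a3⟩; exact ⟨a1, a2, by rw [h t a1.le (a2.trans hk)]; exact a3⟩
  obtain ⟨h1, h2, h3, h4, h5⟩ := hc
  refine ⟨h1, by rw [← h i le_rfl h1.le]; exact h2, by rw [← h j h1.le le_rfl]; exact h3, ?_, ?_⟩
  · rw [← hcnt _ j le_rfl, ← hcnt _ j le_rfl]; exact h4
  · intro k a1 a2
    rw [← hcnt _ k a2.le, ← hcnt _ k a2.le]; exact h5 k a1 a2

theorem noncross {l : Wt N} {p q i j : Fin N} (h : IsCircle l p q) (h' : IsCircle l i j)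
    (h1 : p < i) (h2 : i < q) : j < q := by
  by_contra hh
  rw [isCircle_iff] at h h'
  obtain ⟨a1, a2, a3⟩ := h
  obtain ⟨b1, b2, b3⟩ := h'
  simp only [Fin.lt_def] at *
  have x1 := a3 i.val (by omega) (by omega)
  rcases Nat.eq_or_lt_of_le (not_lt.1 hh) with he | hl
  · rw [he] at a2; omega
  · have := b3 (q.val + 1) (by omega) (by omega); omega

end Kh

namespace Kh

/-- (0-based vertices: `λ_t = v (t-1)`, circles `C_i = (a i, b i)`,
`μ_{t+1} = s_{C_k}(λ_t)`.)  If some circle of `λ_1` encloses `C_k` and is strictly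
enclosed in `C_1`, then the path `ȳ_{λ_1}^{μ_2} ⋯ ȳ_{μ_k}^{λ_{k+1}}` exists in
`Q̄_m^n` and the two stated differences lie in the ideal `Ī_m^n` (i.e. vanish
in `K̄_m^n`). -/
theorem statement16 (F : Type*) [Field F] (m n : ℕ) (hm : 1 ≤ m) (hn : 1 ≤ n)
    (N : ℕ) (hN : N = m + n)
    (k : ℕ) (hk : 3 ≤ k) (v : ℕ → Wt N) (a b : ℕ → Fin N)
    (hw : IsWeight m n (v 0))
    (hstep : ∀ i, 1 ≤ i → i ≤ k →
      IsCircle (v (i - 1)) (a i) (b i) ∧ v i = swapC (v (i - 1)) (a i) (b i))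
    (hnot : ∀ i, 2 ≤ i → i ≤ k - 1 → ¬ IsCircle (v (i - 2)) (a i) (b i))
    (hall : ∀ j, 1 ≤ j → j ≤ k → IsCircle (v (j - 1)) (a k) (b k))
    (henc : Encloses (a 1) (b 1) (a k) (b k))
    (hleft : ∀ i, 2 ≤ i → i ≤ k - 1 → LeftOf (a k) (b k) (a i) (b i))
    (hmid : ∃ p q : Fin N, IsCircle (v 0) p q ∧ Encloses p q (a k) (b k) ∧
      Encloses (a 1) (b 1) p q) :
    ((List.ofFn (fun t : Fin (k + 1) =>
        if t.val = 0 then v 0 else if t.val = k then v k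
        else swapC (v (t.val - 1)) (a k) (b k))).Chain' GammaStep ∧
      ∀ x ∈ List.ofFn (fun t : Fin (k + 1) =>
        if t.val = 0 then v 0 else if t.val = k then v k
        else swapC (v (t.val - 1)) (a k) (b k)), IsWeight m n x) ∧
    toKbar F m n N
      (pathEl F m n N (List.ofFn (fun t : Fin (k + 1) => v t.val)) -
        ((-1 : F) ^ (k - 1)) •
          pathEl F m n N (List.ofFn (fun t : Fin (k + 1) =>
            if t.val = 0 then v 0 else if t.val = k then v k
            else swapC (v (t.val - 1)) (a k) (b k)))) = 0 ∧
    toKbar F m n N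
      (pathEl F m n N (List.ofFn (fun t : Fin (k + 1) => v t.val)).reverse -
        ((-1 : F) ^ (k - 1)) •
          pathEl F m n N (List.ofFn (fun t : Fin (k + 1) =>
            if t.val = 0 then v 0 else if t.val = k then v k
            else swapC (v (t.val - 1)) (a k) (b k))).reverse) = 0 := by
  have hsq : (∀ t, t ≤ k - 1 → IsWeight m n (v t)) ∧ ∀ t, t < k - 1 →
      Sq (v t) (a k) (b k) (a (t + 1)) (b (t + 1)) := by
    obtain ⟨p, q, hpq, hpqC, hpqD⟩ := hmid
    have inv : ∀ t, t ≤ k - 1 → IsWeight m n (v t) ∧ (∀ x, p ≤ x → x ≤ q → v t x = v 0 x) ∧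
        (1 ≤ t → (a t < p ∧ q < b t) ∨ q < a t) := by
      intro t
      induction t using Nat.strong_induction_on with
      | _ t ih =>
        intro ht
        rcases Nat.eq_zero_or_pos t with rfl | hpos
        · exact ⟨hw, fun _ _ _ => rfl, fun h => by omega⟩
        obtain ⟨i1, i2, -⟩ := ih (t - 1) (by omega) (by omega)
        obtain ⟨s1, s2⟩ := hstep t hpos (by omega)
        have hcl : (a t < p ∧ q < b t) ∨ q < a t := by
          by_cases h1 : t = 1
          · subst h1; exact Or.inl hpqD
          · right
            have hl : b k < a t := hleft t (by omega) ht
            have hpa : p < a t := hpqC.1.trans ((hall 1 le_rfl (by omega)).1.trans hl)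
            by_contra hqa
            have hpq' : IsCircle (v (t - 1)) p q :=
              circ_congr (fun x h1 h2 => (i2 x h1 h2).symm) hpq
            have hne : a t ≠ q := by
              intro hh
              have e1 := s1.2.1
              rw [hh, hpq'.2.2.1] at e1
              exact Bool.noConfusion e1
            have hlt : a t < q := lt_of_le_of_ne (not_lt.1 hqa) hne
            have hbq := noncross hpq' s1 hpa hlt
            obtain ⟨-, i3, -⟩ := ih (t - 2) (by omega) (by omega)
            exact hnot t (by omega) ht (circ_congr (fun x h1 h2 => by
              rw [i2 x (hpa.le.trans h1) (h2.trans hbq.le),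
                i3 x (hpa.le.trans h1) (h2.trans hbq.le)]) s1)
        refine ⟨by rw [s2]; exact swapC_weight _ _ _ i1, ?_, fun _ => hcl⟩
        intro x hx1 hx2
        rw [← i2 x hx1 hx2, s2]
        by_contra hh
        have hab := s1.1
        rcases swap_ne hh with rfl | rfl <;> simp only [Fin.lt_def, Fin.le_def] at * <;> omega
    refine ⟨fun t ht => (inv t ht).1, fun t ht => ?_⟩
    obtain ⟨i1, i2, -⟩ := inv t ht.le
    obtain ⟨-, -, i3⟩ := inv (t + 1) (by omega)
    exact ⟨hall (t + 1) (by omega) (by omega), (hstep (t + 1) (by omega) (by omega)).1,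
      p, q, circ_congr (fun x h1 h2 => (i2 x h1 h2).symm) hpq, hpqC.1, hpqC.2, i3 (by omega)⟩
  obtain ⟨hwt, hsq⟩ := hsq
  obtain ⟨j, rfl⟩ : ∃ j, k = j + 1 := ⟨k - 1, by omega⟩
  simp only [Nat.add_sub_cancel] at hwt hsq ⊢
  set w : ℕ → Wt N := fun t => swapC (v t) (a (j + 1)) (b (j + 1)) with hwdef
  have hvs : ∀ t, t < j + 1 → v (t + 1) = swapC (v t) (a (t + 1)) (b (t + 1)) := fun t ht =>
    (hstep (t + 1) (by omega) (by omega)).2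
  have hvw : v (j + 1) = w j := hvs j (by omega)
  have hws : ∀ t, t < j → w (t + 1) = swapC (w t) (a (t + 1)) (b (t + 1)) := by
    intro t ht
    rw [hwdef]
    simp only
    rw [hvs t (by omega), (hsq t ht).comm]
  have hlist : List.ofFn (fun t : Fin (j + 1 + 1) =>
        if t.val = 0 then v 0 else if t.val = j + 1 then v (j + 1)
        else swapC (v (t.val - 1)) (a (j + 1)) (b (j + 1))) =
      v 0 :: List.ofFn (fun t : Fin (j + 1) => w t.val) := by
    rw [List.ofFn_succ]
    congr 1
    congr 1
    funext t
    simp only [Fin.val_succ, Nat.add_sub_cancel]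
    rw [if_neg (by omega)]
    split_ifs with h
    · have : t.val = j := by omega
      rw [this, hvw]
    · rfl
  have hasc := fun t ht => (hsq t ht).asc F (hwt t (by omega)) (by
    have := hall (t + 2) (by omega) (by omega)
    rw [← hvs t (by omega)]; exact this)
  have hlist2 : (List.ofFn (fun t : Fin (j + 1 + 1) => v t.val)).reverse =
      w j :: (List.ofFn (fun t : Fin (j + 1) => v t.val)).reverse := by
    rw [List.ofFn_succ', ← hvw]
    simp
  have hww : ∀ t, t ≤ j → IsWeight m n (w t) := fun t ht => swapC_weight _ _ _ (hwt t ht)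
  rw [hlist]
  refine ⟨⟨?_, ?_⟩, ?_, ?_⟩
  · have hc : (List.ofFn (fun t : Fin (j + 1) => w t.val)).IsChain GammaStep := by
      rw [List.isChain_iff_getElem]
      intro i hi
      simp only [List.getElem_ofFn]
      simp only [List.length_ofFn] at hi
      have hs := hsq i (by omega)
      exact ⟨a (i + 1), b (i + 1), hs.circ, hws i (by omega)⟩
    change List.IsChain _ _
    rw [List.ofFn_succ] at hc ⊢
    rw [List.isChain_cons_cons]
    exact ⟨⟨a (j + 1), b (j + 1), hall 1 le_rfl (by omega), rfl⟩, hc⟩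
  · intro x hx
    rcases List.mem_cons.1 hx with rfl | hx
    · exact hw
    · rw [List.mem_ofFn] at hx
      obtain ⟨t, rfl⟩ := hx
      exact hww t.val (by omega)
  · rw [map_sub, map_smul, sub_eq_zero]
    refine asc_claim F m n j v w hvw (fun t ht => ?_)
    have := (hasc t ht).1
    rw [← hvs t (by omega)] at this
    exact this
  · rw [map_sub, map_smul, sub_eq_zero, hlist2, List.reverse_cons]
    refine desc_claim F m n j v w (fun t ht => ?_)
    have := (hasc t ht).2
    rw [← hvs t (by omega)] at this
    exact this

end Kh
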